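/- For every real Banach space X, every n ∈ ℕ, every p ∈ [1,∞), every τ > 0 and every f : {-1,1}^n → X with E_ε f = 0, one has (E_ε‖P_τ f‖_X^p)^{1/p} ≤ log((1+e^{-τ})/(1−e^{-τ})) · (E_{ε,δ}‖Σ_{j=1}^n δ_j D_j f(ε)‖_X^p)^{1/p}. -/

import Mathlib

open scoped BigOperators
open Finset

noncomputable section

/-- The ±1 value of a Boolean coordinate. -/
def rad (b : Bool) : ℝ := if b then 1 else -1

/-- Expectation over the uniform measure on the discrete cube `{-1,1}^n`
(points encoded as `Fin n → Bool`). -/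
def cubeAvg {n : ℕ} {X : Type*} [AddCommGroup X] [Module ℝ X]
    (f : (Fin n → Bool) → X) : X :=
  ((2 ^ n : ℝ)⁻¹) • ∑ ε : Fin n → Bool, f ε

/-- Walsh character `w_A(ε) = ∏_{i ∈ A} ε_i`. -/
def walshChar {n : ℕ} (A : Finset (Fin n)) (ε : Fin n → Bool) : ℝ :=
  ∏ i ∈ A, rad (ε i)

/-- Walsh coefficient `f̂(A) = E_ε [f(ε) w_A(ε)]`. -/
def wcoef {n : ℕ} {X : Type*} [AddCommGroup X] [Module ℝ X]
    (f : (Fin n → Bool) → X) (A : Finset (Fin n)) : X :=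
  cubeAvg (fun ε => walshChar A ε • f ε)

/-- Flip the `j`-th coordinate. -/
def flipCoord {n : ℕ} (j : Fin n) (ε : Fin n → Bool) : Fin n → Bool :=
  Function.update ε j (!(ε j))

/-- Discrete derivative `D_j f(ε) = (f(ε) - f(σ_j ε))/2`. -/
def Dop {n : ℕ} {X : Type*} [AddCommGroup X] [Module ℝ X]
    (j : Fin n) (f : (Fin n → Bool) → X) : (Fin n → Bool) → X :=
  fun ε => (2 : ℝ)⁻¹ • (f ε - f (flipCoord j ε))

/-- Heat semigroup `P_t f = Σ_A e^{-t|A|} f̂(A) w_A`. -/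
def heatOp {n : ℕ} {X : Type*} [AddCommGroup X] [Module ℝ X]
    (t : ℝ) (f : (Fin n → Bool) → X) : (Fin n → Bool) → X :=
  fun ε => ∑ A : Finset (Fin n), (Real.exp (-t * A.card) * walshChar A ε) • wcoef f A

/-- Fractional power of the Laplacian on mean-zero parts:
`Δ^a f = Σ_{A ≠ ∅} |A|^a f̂(A) w_A`. -/
def lapPow {n : ℕ} {X : Type*} [AddCommGroup X] [Module ℝ X]
    (a : ℝ) (f : (Fin n → Bool) → X) : (Fin n → Bool) → X :=
  fun ε => ∑ A ∈ Finset.univ.filter (fun A : Finset (Fin n) => A ≠ ∅),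
    (((A.card : ℝ)) ^ a * walshChar A ε) • wcoef f A

/-- `X` has cotype `q` with constant `K`. -/
def HasCotypeConst (X : Type*) [NormedAddCommGroup X] [NormedSpace ℝ X] (q K : ℝ) : Prop :=
  ∀ m : ℕ, ∀ x : Fin m → X,
    (∑ j, ‖x j‖ ^ q) ^ (1 / q) ≤
      K * (cubeAvg (fun δ : Fin m → Bool => ‖∑ j, rad (δ j) • x j‖ ^ (2 : ℝ))) ^ (1 / 2 : ℝ)

/-- `X` has type `s` with constant `T`. -/
def HasTypeConst (X : Type*) [NormedAddCommGroup X] [NormedSpace ℝ X] (s T : ℝ) : Prop :=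
  ∀ m : ℕ, ∀ x : Fin m → X,
    (cubeAvg (fun δ : Fin m → Bool => ‖∑ j, rad (δ j) • x j‖ ^ (2 : ℝ))) ^ (1 / 2 : ℝ) ≤
      T * (∑ j, ‖x j‖ ^ s) ^ (1 / s)

lemma hp_rad_beq (a b : Bool) : rad (a == b) = rad a * rad b := by
  cases a <;> cases b <;> simp [rad]

lemma hp_rad_sq (a : Bool) : rad a * rad a = 1 := by
  cases a <;> simp [rad]

lemma hp_sum_prod {n : ℕ} (g : Fin n → Bool → ℝ) :
    ∑ ξ : Fin n → Bool, ∏ j, g j (ξ j) = ∏ j, (g j true + g j false) := by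
  have h := Finset.prod_univ_sum (fun _ : Fin n => (Finset.univ : Finset Bool)) g
  rw [Fintype.piFinset_univ] at h
  rw [← h]
  simp

/-- Pointwise product of two points of the cube. -/
def hpMul {n : ℕ} (ε ξ : Fin n → Bool) : Fin n → Bool := fun i => (ε i == ξ i)

lemma hpMul_invol {n : ℕ} (ξ : Fin n → Bool) :
    Function.Involutive (fun ε => hpMul ε ξ) := by
  intro ε
  funext i
  simp only [hpMul]
  cases ε i <;> cases ξ i <;> rfl

lemma hp_sum_mul {n : ℕ} {Y : Type*} [AddCommMonoid Y] (ξ : Fin n → Bool)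
    (g : (Fin n → Bool) → Y) : ∑ ε, g (hpMul ε ξ) = ∑ ε, g ε :=
  Equiv.sum_comp (hpMul_invol ξ).toPerm g

/-- Biased product weight. -/
def hpW {n : ℕ} (r : ℝ) (ξ : Fin n → Bool) : ℝ := ∏ j, ((1 + r * rad (ξ j)) / 2)

lemma hpW_nonneg {n : ℕ} {r : ℝ} (h0 : 0 ≤ r) (h1 : r < 1) (ξ : Fin n → Bool) :
    0 ≤ hpW r ξ := by
  apply Finset.prod_nonneg
  intro j _
  cases ξ j <;> simp [rad] <;> linarith

lemma hpW_sum {n : ℕ} (r : ℝ) : ∑ ξ : Fin n → Bool, hpW r ξ = 1 := by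
  unfold hpW
  rw [hp_sum_prod (fun _ b => (1 + r * rad b) / 2)]
  apply Finset.prod_eq_one
  intro j _
  simp only [rad, if_true]
  norm_num
  ring

lemma hpW_mean {n : ℕ} (r : ℝ) (j : Fin n) :
    ∑ ξ : Fin n → Bool, hpW r ξ * rad (ξ j) = r := by
  have h := hp_sum_prod (fun (k : Fin n) b => (1 + r * rad b) / 2 * (if k = j then rad b else 1))
  have e : ∀ ξ : Fin n → Bool, hpW r ξ * rad (ξ j) =
      ∏ k, ((1 + r * rad (ξ k)) / 2 * (if k = j then rad (ξ k) else 1)) := by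
    intro ξ
    rw [Finset.prod_mul_distrib, Finset.prod_ite_eq' Finset.univ j]
    simp [hpW]
  simp_rw [e]
  rw [h]
  have : ∀ k : Fin n, ((1 + r * rad true) / 2 * (if k = j then rad true else 1) +
      (1 + r * rad false) / 2 * (if k = j then rad false else 1)) = if k = j then r else 1 := by
    intro k
    split_ifs <;> simp [rad] <;> ring
  simp_rw [this]
  rw [Finset.prod_ite_eq' Finset.univ j]
  simp

lemma hpW_walsh {n : ℕ} (r : ℝ) (A : Finset (Fin n)) (j : Fin n) (hj : j ∈ A) :
    ∑ ξ : Fin n → Bool, hpW r ξ * ((rad (ξ j) - r) * walshChar A ξ) =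
      (1 - r ^ 2) * r ^ (A.card - 1) := by
  have h := hp_sum_prod (fun (k : Fin n) b => (1 + r * rad b) / 2 *
    ((if k = j then rad b - r else 1) * (if k ∈ A then rad b else 1)))
  have e : ∀ ξ : Fin n → Bool, hpW r ξ * ((rad (ξ j) - r) * walshChar A ξ) =
      ∏ k, ((1 + r * rad (ξ k)) / 2 *
    ((if k = j then rad (ξ k) - r else 1) * (if k ∈ A then rad (ξ k) else 1))) := by
    intro ξ
    rw [Finset.prod_mul_distrib, Finset.prod_mul_distrib, Finset.prod_ite_eq' Finset.univ j]
    simp [hpW, walshChar]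
  simp_rw [e]
  rw [h]
  have : ∀ k : Fin n, ((1 + r * rad true) / 2 *
    ((if k = j then rad true - r else 1) * (if k ∈ A then rad true else 1)) +
      (1 + r * rad false) / 2 *
    ((if k = j then rad false - r else 1) * (if k ∈ A then rad false else 1))) =
      (if k = j then 1 - r ^ 2 else 1) * (if k ∈ A.erase j then r else 1) := by
    intro k
    by_cases hk : k = j
    · subst hk
      simp [rad, hj]; ring
    · by_cases hA : k ∈ A <;> simp [rad, hk, hA] <;> ring
  simp_rw [this]
  rw [Finset.prod_mul_distrib, Finset.prod_ite_eq' Finset.univ j, Finset.prod_ite_mem]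
  simp [Finset.card_erase_of_mem hj]

lemma hp_walsh_mul {n : ℕ} (A : Finset (Fin n)) (ε ξ : Fin n → Bool) :
    walshChar A (hpMul ε ξ) = walshChar A ε * walshChar A ξ := by
  simp only [walshChar, hpMul, hp_rad_beq, Finset.prod_mul_distrib]

lemma hp_walsh_flip {n : ℕ} (A : Finset (Fin n)) (j : Fin n) (ε : Fin n → Bool) :
    walshChar A (flipCoord j ε) = (if j ∈ A then -1 else 1) * walshChar A ε := by
  have hr : ∀ i, rad (flipCoord j ε i) = (if i = j then -1 else 1) * rad (ε i) := by
    intro i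
    by_cases h : i = j
    · subst h
      cases h : ε i <;> simp [flipCoord, rad, h]
    · simp [flipCoord, h]
  simp only [walshChar, hr, Finset.prod_mul_distrib, Finset.prod_ite_eq']

lemma hp_walsh_orth {n : ℕ} (ε η : Fin n → Bool) :
    ∑ A : Finset (Fin n), walshChar A ε * walshChar A η = if η = ε then (2 : ℝ) ^ n else 0 := by
  have h := Finset.prod_one_add (f := fun i => rad (ε i) * rad (η i)) (Finset.univ : Finset (Fin n))
  have e : ∑ A : Finset (Fin n), walshChar A ε * walshChar A η =
      ∏ i, (1 + rad (ε i) * rad (η i)) := by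
    rw [h]
    simp [walshChar, Finset.prod_mul_distrib]
  rw [e]
  split_ifs with hη
  · subst hη
    simp only [hp_rad_sq]
    norm_num
  · obtain ⟨i, hi⟩ := Function.ne_iff.mp hη
    apply Finset.prod_eq_zero (Finset.mem_univ i)
    revert hi
    cases ε i <;> cases η i <;> simp [rad]

section
variable {n : ℕ} {X : Type*} [NormedAddCommGroup X] [NormedSpace ℝ X]

lemma hp_inversion (f : (Fin n → Bool) → X) (ε : Fin n → Bool) :
    f ε = ∑ A : Finset (Fin n), walshChar A ε • wcoef f A := by
  simp only [wcoef, cubeAvg, Finset.smul_sum, smul_smul]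
  rw [Finset.sum_comm]
  have : ∀ η : Fin n → Bool, ∑ A : Finset (Fin n),
      (walshChar A ε * ((2 ^ n : ℝ)⁻¹ * walshChar A η)) • f η =
      if η = ε then f η else 0 := by
    intro η
    rw [← Finset.sum_smul]
    have : ∑ A : Finset (Fin n), (walshChar A ε * ((2 ^ n : ℝ)⁻¹ * walshChar A η)) =
      (2 ^ n : ℝ)⁻¹ * ∑ A : Finset (Fin n), walshChar A ε * walshChar A η := by
      rw [Finset.mul_sum]
      exact Finset.sum_congr rfl (fun A _ => by ring)
    rw [this, hp_walsh_orth]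
    split_ifs <;> simp
  simp_rw [this]
  simp

lemma hp_Dop (f : (Fin n → Bool) → X) (j : Fin n) (ε : Fin n → Bool) :
    Dop j f ε = ∑ A : Finset (Fin n), (if j ∈ A then walshChar A ε else 0) • wcoef f A := by
  rw [Dop, hp_inversion f ε, hp_inversion f (flipCoord j ε), ← Finset.sum_sub_distrib,
    Finset.smul_sum]
  refine Finset.sum_congr rfl (fun A _ => ?_)
  rw [hp_walsh_flip, ← sub_smul, smul_smul]
  congr 1
  split_ifs <;> ring

lemma hp_formula (f : (Fin n → Bool) → X) (r : ℝ) (ε : Fin n → Bool) :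
    ∑ ξ : Fin n → Bool, hpW r ξ • ∑ j, (rad (ξ j) - r) • Dop j f (hpMul ε ξ) =
      (1 - r ^ 2) • ∑ A : Finset (Fin n),
        (((A.card : ℝ) * r ^ (A.card - 1)) * walshChar A ε) • wcoef f A := by
  simp only [hp_Dop, Finset.smul_sum, smul_smul]
  have h1 : ∀ ξ : Fin n → Bool, ∑ j : Fin n, ∑ A : Finset (Fin n), (hpW r ξ * ((rad (ξ j) - r) *
      if j ∈ A then walshChar A (hpMul ε ξ) else 0)) • wcoef f A =
      ∑ A : Finset (Fin n), ∑ j : Fin n, (hpW r ξ * ((rad (ξ j) - r) *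
      if j ∈ A then walshChar A (hpMul ε ξ) else 0)) • wcoef f A := fun ξ => Finset.sum_comm
  simp_rw [h1]
  rw [Finset.sum_comm]
  refine Finset.sum_congr rfl (fun A _ => ?_)
  rw [Finset.sum_comm]
  simp_rw [← Finset.sum_smul]
  congr 1
  have : ∀ j : Fin n, ∑ ξ : Fin n → Bool, (hpW r ξ * ((rad (ξ j) - r) *
      if j ∈ A then walshChar A (hpMul ε ξ) else 0)) =
      if j ∈ A then (1 - r ^ 2) * r ^ (A.card - 1) * walshChar A ε else 0 := by
    intro j
    split_ifs with hj
    · rw [← hpW_walsh r A j hj, Finset.sum_mul]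
      refine Finset.sum_congr rfl (fun ξ _ => ?_)
      rw [hp_walsh_mul]; ring
    · simp
  simp_rw [this]
  rw [Finset.sum_ite_mem, Finset.univ_inter, Finset.sum_const, nsmul_eq_mul]
  ring

lemma hp_jensen {ι : Type*} (s : Finset ι) (w : ι → ℝ) (x : ι → X) {p : ℝ} (hp : 1 ≤ p)
    (hw : ∀ i ∈ s, 0 ≤ w i) (hw1 : ∑ i ∈ s, w i = 1) :
    ‖∑ i ∈ s, w i • x i‖ ^ p ≤ ∑ i ∈ s, w i * ‖x i‖ ^ p := by
  refine le_trans ?_ (Real.rpow_arith_mean_le_arith_mean_rpow s w (fun i => ‖x i‖) hw hw1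
    (fun i _ => norm_nonneg _) hp)
  apply Real.rpow_le_rpow (norm_nonneg _) _ (by linarith)
  refine (norm_sum_le _ _).trans (Finset.sum_le_sum (fun i hi => ?_))
  rw [norm_smul, Real.norm_of_nonneg (hw i hi)]

lemma hp_sub_rpow (a b : X) {p : ℝ} (hp : 1 ≤ p) :
    ‖a - b‖ ^ p ≤ (2 : ℝ) ^ p * (1 / 2 * ‖a‖ ^ p + 1 / 2 * ‖b‖ ^ p) := by
  have h := (convexOn_rpow hp).2 (Set.mem_Ici.mpr (norm_nonneg a)) (Set.mem_Ici.mpr (norm_nonneg b))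
    (show (0 : ℝ) ≤ 1 / 2 by norm_num) (show (0 : ℝ) ≤ 1 / 2 by norm_num) (by norm_num)
  simp only [smul_eq_mul] at h
  have h2 : ‖a - b‖ ^ p ≤ (2 * (1 / 2 * ‖a‖ + 1 / 2 * ‖b‖)) ^ p := by
    apply Real.rpow_le_rpow (norm_nonneg _) _ (by linarith)
    have := norm_sub_le a b
    linarith
  rw [Real.mul_rpow (by norm_num) (by positivity)] at h2
  exact h2.trans (mul_le_mul_of_nonneg_left h (by positivity))

/-- Coordinatewise swap. -/
def hpSwap (δ : Fin n → Bool) (q : (Fin n → Bool) × (Fin n → Bool)) :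
    (Fin n → Bool) × (Fin n → Bool) :=
  (fun i => if δ i then q.1 i else q.2 i, fun i => if δ i then q.2 i else q.1 i)

lemma hpSwap_invol (δ : Fin n → Bool) : Function.Involutive (hpSwap δ) := by
  intro q
  apply Prod.ext
  · funext i
    cases h : δ i <;> simp [hpSwap, h]
  · funext i
    cases h : δ i <;> simp [hpSwap, h]

lemma hpSwap_W (δ : Fin n → Bool) (r : ℝ) (q : (Fin n → Bool) × (Fin n → Bool)) :
    hpW r (hpSwap δ q).1 * hpW r (hpSwap δ q).2 = hpW r q.1 * hpW r q.2 := by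
  simp only [hpW, ← Finset.prod_mul_distrib]
  refine Finset.prod_congr rfl (fun i _ => ?_)
  cases h : δ i <;> simp [hpSwap, h]
  ring

lemma hpSwap_sub (δ : Fin n → Bool) (q : (Fin n → Bool) × (Fin n → Bool)) (i : Fin n) :
    rad ((hpSwap δ q).1 i) - rad ((hpSwap δ q).2 i) =
      rad (hpMul δ q.1 i) - rad (hpMul δ q.2 i) := by
  simp only [hpMul, hp_rad_beq]
  cases h : δ i <;> cases h1 : q.1 i <;> cases h2 : q.2 i <;> simp [hpSwap, h, h1, h2, rad]

lemma hp_symm (x : Fin n → X) {p r : ℝ} (hp : 1 ≤ p) (h0 : 0 ≤ r) (h1 : r < 1) :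
    ∑ ξ : Fin n → Bool, hpW r ξ * ‖∑ j, (rad (ξ j) - r) • x j‖ ^ p ≤
      (2 : ℝ) ^ p * cubeAvg (fun δ : Fin n → Bool => ‖∑ j, rad (δ j) • x j‖ ^ p) := by
  set Φ : (Fin n → Bool) → ℝ := fun δ => ‖∑ j, rad (δ j) • x j‖ ^ p with hΦ
  set G : (Fin n → Bool) × (Fin n → Bool) → ℝ :=
    fun q => hpW r q.1 * hpW r q.2 * ‖∑ j, (rad (q.1 j) - rad (q.2 j)) • x j‖ ^ p with hG
  have step1 : ∑ ξ : Fin n → Bool, hpW r ξ * ‖∑ j, (rad (ξ j) - r) • x j‖ ^ p ≤ ∑ q, G q := by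
    rw [Fintype.sum_prod_type]
    refine Finset.sum_le_sum (fun ξ _ => ?_)
    simp only [hG, mul_assoc]
    rw [← Finset.mul_sum]
    refine mul_le_mul_of_nonneg_left ?_ (hpW_nonneg h0 h1 ξ)
    refine le_trans (le_of_eq ?_) (hp_jensen Finset.univ (hpW r)
      (fun ξ' => ∑ j, (rad (ξ j) - rad (ξ' j)) • x j) hp (fun i _ => hpW_nonneg h0 h1 i)
      (hpW_sum r))
    congr 2
    simp only [Finset.smul_sum, smul_smul]
    rw [Finset.sum_comm]
    refine Finset.sum_congr rfl (fun j _ => ?_)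
    rw [← Finset.sum_smul]
    congr 1
    simp only [mul_sub]
    rw [Finset.sum_sub_distrib, hpW_mean, ← Finset.sum_mul, hpW_sum, one_mul]
  have step2 : ∀ δ : Fin n → Bool, ∑ q, G q ≤
      ∑ q : (Fin n → Bool) × (Fin n → Bool), hpW r q.1 * hpW r q.2 *
        ((2 : ℝ) ^ p * (1 / 2 * Φ (hpMul δ q.1) + 1 / 2 * Φ (hpMul δ q.2))) := by
    intro δ
    rw [← Equiv.sum_comp (hpSwap_invol δ).toPerm G]
    refine Finset.sum_le_sum (fun q _ => ?_)
    simp only [hG, Function.Involutive.coe_toPerm, hpSwap_W, hpSwap_sub]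
    refine mul_le_mul_of_nonneg_left ?_ (mul_nonneg (hpW_nonneg h0 h1 _) (hpW_nonneg h0 h1 _))
    simp only [sub_smul, Finset.sum_sub_distrib]
    exact hp_sub_rpow _ _ hp
  have step3 := Finset.sum_le_sum (fun δ (_ : δ ∈ (Finset.univ : Finset (Fin n → Bool))) => step2 δ)
  rw [Finset.sum_comm (s := Finset.univ) (t := Finset.univ)
    (f := fun (δ : Fin n → Bool) (q : (Fin n → Bool) × (Fin n → Bool)) => hpW r q.1 * hpW r q.2 *
        ((2 : ℝ) ^ p * (1 / 2 * Φ (hpMul δ q.1) + 1 / 2 * Φ (hpMul δ q.2))))] at step3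
  have e3 : ∀ q : (Fin n → Bool) × (Fin n → Bool), ∑ δ : Fin n → Bool, hpW r q.1 * hpW r q.2 *
        ((2 : ℝ) ^ p * (1 / 2 * Φ (hpMul δ q.1) + 1 / 2 * Φ (hpMul δ q.2))) =
        hpW r q.1 * hpW r q.2 * ((2 : ℝ) ^ p * ∑ δ, Φ δ) := by
    intro q
    rw [← Finset.mul_sum, ← Finset.mul_sum, Finset.sum_add_distrib, ← Finset.mul_sum,
      ← Finset.mul_sum, hp_sum_mul, hp_sum_mul]
    ring
  simp_rw [e3] at step3
  have e4 : ∑ q : (Fin n → Bool) × (Fin n → Bool), hpW r q.1 * hpW r q.2 *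
      ((2 : ℝ) ^ p * ∑ δ, Φ δ) = (2 : ℝ) ^ p * ∑ δ, Φ δ := by
    rw [← Finset.sum_mul, Fintype.sum_prod_type]
    simp only [← Finset.mul_sum, hpW_sum, mul_one, one_mul]
  rw [e4, Finset.sum_const, nsmul_eq_mul] at step3
  have hc : ((Finset.univ : Finset (Fin n → Bool)).card : ℝ) = 2 ^ n := by simp
  rw [hc] at step3
  refine step1.trans ?_
  rw [cubeAvg, smul_eq_mul]
  have h2 : (0 : ℝ) < 2 ^ n := by positivity
  rw [← mul_assoc, mul_comm ((2 : ℝ) ^ p), mul_assoc, ← div_eq_inv_mul, le_div_iff₀ h2, mul_comm]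
  exact step3

lemma hp_deriv_bound (f : (Fin n → Bool) → X) {p r : ℝ} (hp : 1 ≤ p) (h0 : 0 ≤ r) (h1 : r < 1) :
    ∑ ε : Fin n → Bool, ‖∑ A : Finset (Fin n),
        (((A.card : ℝ) * r ^ (A.card - 1)) * walshChar A ε) • wcoef f A‖ ^ p ≤
      (2 / (1 - r ^ 2)) ^ p * ∑ ε, cubeAvg (fun δ : Fin n → Bool =>
          ‖∑ j, rad (δ j) • Dop j f ε‖ ^ p) := by
  have hr : 0 < 1 - r ^ 2 := by nlinarith
  have key : ∑ ε : Fin n → Bool, ‖(1 - r ^ 2) • ∑ A : Finset (Fin n),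
        (((A.card : ℝ) * r ^ (A.card - 1)) * walshChar A ε) • wcoef f A‖ ^ p ≤
      (2 : ℝ) ^ p * ∑ ε, cubeAvg (fun δ : Fin n → Bool =>
          ‖∑ j, rad (δ j) • Dop j f ε‖ ^ p) := by
    simp_rw [← hp_formula]
    calc _ ≤ ∑ ε : Fin n → Bool, ∑ ξ : Fin n → Bool,
          hpW r ξ * ‖∑ j, (rad (ξ j) - r) • Dop j f (hpMul ε ξ)‖ ^ p :=
          Finset.sum_le_sum (fun ε _ => hp_jensen _ _ _ hp (fun i _ => hpW_nonneg h0 h1 i)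
            (hpW_sum r))
      _ = ∑ ξ : Fin n → Bool, ∑ ε : Fin n → Bool,
          hpW r ξ * ‖∑ j, (rad (ξ j) - r) • Dop j f ε‖ ^ p := by
          rw [Finset.sum_comm]
          exact Finset.sum_congr rfl (fun ξ _ => hp_sum_mul ξ
            (fun ε => hpW r ξ * ‖∑ j, (rad (ξ j) - r) • Dop j f ε‖ ^ p))
      _ = ∑ ε : Fin n → Bool, ∑ ξ : Fin n → Bool,
          hpW r ξ * ‖∑ j, (rad (ξ j) - r) • Dop j f ε‖ ^ p := Finset.sum_comm
      _ ≤ _ := by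
          rw [Finset.mul_sum]
          exact Finset.sum_le_sum (fun ε _ => hp_symm _ hp h0 h1)
  simp_rw [norm_smul, Real.norm_of_nonneg hr.le, Real.mul_rpow hr.le (norm_nonneg _)] at key
  rw [← Finset.mul_sum] at key
  rw [Real.div_rpow (by norm_num) hr.le, div_mul_eq_mul_div, le_div_iff₀ (by positivity), mul_comm]
  exact key

lemma hp_log_deriv (C r : ℝ) (h0 : 0 ≤ r) (h1 : r < 1) :
    HasDerivAt (fun r => (Real.log (1 + r) - Real.log (1 - r)) * C) (2 / (1 - r ^ 2) * C) r := by
  have a : HasDerivAt (fun r => Real.log (1 + r)) (1 / (1 + r)) r :=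
    ((hasDerivAt_id r).const_add 1).log (by simp; linarith)
  have b : HasDerivAt (fun r => Real.log (1 - r)) (-1 / (1 - r)) r :=
    ((hasDerivAt_id r).const_sub 1).log (by simp; linarith)
  have := (a.sub b).mul_const C
  have k1 : 1 + r ≠ 0 := by linarith
  have k2 : 1 - r ≠ 0 := by linarith
  have k3 : 1 - r ^ 2 ≠ 0 := by nlinarith
  have e : 2 / (1 - r ^ 2) * C = (1 / (1 + r) - -1 / (1 - r)) * C := by
    congr 1
    rw [show 1 - r ^ 2 = (1 + r) * (1 - r) by ring]
    field_simp
    ring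
  rw [e]
  exact this

lemma hp_main (f : (Fin n → Bool) → X) (hf : cubeAvg f = 0) {p ρ : ℝ} (hp : 1 ≤ p)
    (h0 : 0 ≤ ρ) (h1 : ρ < 1) :
    (∑ ε : Fin n → Bool, ‖∑ A : Finset (Fin n),
        (ρ ^ A.card * walshChar A ε) • wcoef f A‖ ^ p) ^ (1 / p) ≤
      (Real.log (1 + ρ) - Real.log (1 - ρ)) * (∑ ε, cubeAvg (fun δ : Fin n → Bool =>
          ‖∑ j, rad (δ j) • Dop j f ε‖ ^ p)) ^ (1 / p) := by
  have hp0 : 0 < p := by linarith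
  have : Fact (1 ≤ ENNReal.ofReal p) := ⟨by simpa using ENNReal.ofReal_le_ofReal hp⟩
  have hpr : (ENNReal.ofReal p).toReal = p := ENNReal.toReal_ofReal hp0.le
  have hnorm : ∀ g : (Fin n → Bool) → X,
      ‖(WithLp.toLp (ENNReal.ofReal p) g : PiLp (ENNReal.ofReal p) (fun _ : Fin n → Bool => X))‖ =
        (∑ ε, ‖g ε‖ ^ p) ^ (1 / p) := by
    intro g
    rw [PiLp.norm_eq_sum (by rw [hpr]; exact hp0), hpr]
  set S := ∑ ε, cubeAvg (fun δ : Fin n → Bool => ‖∑ j, rad (δ j) • Dop j f ε‖ ^ p) with hS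
  have hS0 : 0 ≤ S := by
    refine Finset.sum_nonneg (fun ε _ => ?_)
    rw [cubeAvg]
    positivity
  let v : Finset (Fin n) → PiLp (ENNReal.ofReal p) (fun _ : Fin n → Bool => X) :=
    fun A => WithLp.toLp _ (fun ε => walshChar A ε • wcoef f A)
  have hv : ∀ c : Finset (Fin n) → ℝ, ∑ A, c A • v A =
      WithLp.toLp _ (fun ε => ∑ A, (c A * walshChar A ε) • wcoef f A) := by
    intro c
    ext ε
    simp [v, smul_smul]
  let F : ℝ → PiLp (ENNReal.ofReal p) (fun _ : Fin n → Bool => X) :=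
    fun r => ∑ A, (r ^ A.card) • v A
  let F' : ℝ → PiLp (ENNReal.ofReal p) (fun _ : Fin n → Bool => X) :=
    fun r => ∑ A, ((A.card : ℝ) * r ^ (A.card - 1)) • v A
  have hF : ∀ r, HasDerivAt F (F' r) r := by
    intro r
    exact HasDerivAt.fun_sum (fun A _ => (hasDerivAt_pow A.card r).smul_const (v A))
  have hB := image_norm_le_of_norm_deriv_right_le_deriv_boundary' (f := F) (f' := F') (a := 0)
    (b := ρ) (B := fun r => (Real.log (1 + r) - Real.log (1 - r)) * S ^ (1 / p))
    (B' := fun r => 2 / (1 - r ^ 2) * S ^ (1 / p))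
    (fun r _ => (hF r).continuousAt.continuousWithinAt)
    (fun r _ => (hF r).hasDerivWithinAt)
    ?_
    (fun r hr => (hp_log_deriv _ r hr.1 (hr.2.trans_lt h1)).continuousAt.continuousWithinAt)
    (fun r hr => (hp_log_deriv _ r hr.1 (hr.2.trans h1)).hasDerivWithinAt)
    ?_ (x := ρ) ⟨h0, le_rfl⟩
  · simp only [F] at hB
    rwa [hv, hnorm] at hB
  · have : F 0 = 0 := by
      simp only [F]
      refine Finset.sum_eq_zero (fun A _ => ?_)
      by_cases hA : A = ∅
      · subst hA
        have : wcoef f ∅ = 0 := by simpa [wcoef, walshChar] using hf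
        ext ε
        simp [v, this]
      · have : A.card ≠ 0 := by simpa using hA
        simp [this]
    rw [this]
    simp
  · intro r hr
    have hr1 := hr.2.trans h1
    have hr2 : 0 < 1 - r ^ 2 := by nlinarith [hr.1]
    simp only [F']
    rw [hv, hnorm]
    refine (Real.rpow_le_rpow (by positivity) (hp_deriv_bound f hp hr.1 hr1)
      (by positivity)).trans (le_of_eq ?_)
    rw [Real.mul_rpow (by positivity) hS0, ← Real.rpow_mul (by positivity)]
    rw [mul_one_div_cancel hp0.ne', Real.rpow_one]

end

/-- `(E‖P_τ f‖^p)^{1/p} ≤ log((1+e^{-τ})/(1-e^{-τ})) (E‖Σ δ_j D_j f‖^p)^{1/p}`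
for mean-zero `f`. -/
theorem heat_pisier_bound {n : ℕ} {X : Type*} [NormedAddCommGroup X]
    [NormedSpace ℝ X] [CompleteSpace X]
    (p τ : ℝ) (hp : 1 ≤ p) (hτ : 0 < τ)
    (f : (Fin n → Bool) → X) (hf : cubeAvg f = 0) :
    (cubeAvg (fun ε => ‖heatOp τ f ε‖ ^ p)) ^ (1 / p) ≤
      Real.log ((1 + Real.exp (-τ)) / (1 - Real.exp (-τ))) *
        (cubeAvg (fun ε => cubeAvg (fun δ : Fin n → Bool =>
          ‖∑ j, rad (δ j) • Dop j f ε‖ ^ p))) ^ (1 / p) := by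
  have hp0 : 0 < p := by linarith
  have e1 : Real.exp (-τ) < 1 := by simpa using hτ
  have e0 : 0 < Real.exp (-τ) := Real.exp_pos _
  have h := hp_main f hf hp e0.le e1
  rw [Real.log_div (by linarith) (by linarith)]
  have hh : ∀ ε, heatOp τ f ε = ∑ A : Finset (Fin n),
        (Real.exp (-τ) ^ A.card * walshChar A ε) • wcoef f A := by
    intro ε
    refine Finset.sum_congr rfl (fun A _ => ?_)
    rw [← Real.exp_nat_mul, mul_comm (-τ)]
  simp_rw [← hh] at h
  rw [cubeAvg, cubeAvg, smul_eq_mul, smul_eq_mul]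
  rw [Real.mul_rpow (by positivity) (by positivity), Real.mul_rpow (by positivity) ?_]
  · rw [mul_left_comm]
    exact mul_le_mul_of_nonneg_left h (by positivity)
  · refine Finset.sum_nonneg (fun ε _ => ?_)
    rw [cubeAvg]
    positivity

end
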